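/- arXiv:2403.07485 — 2 statements merged into one kernel-verified Lean document; each statement's English description precedes it below -/
import Mathlib

section
/- Let f : [−1, 1] → ℝ be Lipschitz continuous. For each n ≥ 1, let p_n be the unique polynomial of degree at most n interpolating f at the n + 1 Chebyshev–Lobatto nodes cos(kπ/n), k = 0, …, n. Then p_n converges to f uniformly on [−1, 1], i.e., sup_{x ∈ [−1,1]} |f(x) − p_n(x)| → 0 as n → ∞. -/
open Polynomial in
theorem cheb_aux_expand (n : ℕ) (p : Polynomial ℝ) (hp : p.natDegree ≤ n) :
    ∃ (c : ℝ) (a : ℕ → ℝ), ∀ θ : ℝ, p.eval (Real.cos θ) =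
      c + ∑ k ∈ Finset.range n, a k * Real.cos ((k + 1 : ℝ) * θ) := by
  have hmem : p ∈ degreeLT ℝ (n + 1) := by
    rw [mem_degreeLT]
    exact (degree_le_of_natDegree_le hp).trans_lt (by exact_mod_cast Nat.lt_succ_self n)
  rw [← Sequence.span_degreeLT (Chebyshev.chebyshevTsequence ℝ)
    (by simp),
    show Set.Iio (n + 1) = ((Finset.range (n + 1) : Finset ℕ) : Set ℕ) by ext; simp,
    Submodule.mem_span_image_finset_iff_exists_fun] at hmem
  obtain ⟨c, hc⟩ := hmem
  obtain ⟨c, hc⟩ : ∃ d : ℕ → ℝ,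
      ∑ i ∈ Finset.range (n + 1), d i • Chebyshev.chebyshevTsequence ℝ i = p := by
    refine ⟨fun i => if h : i ∈ Finset.range (n + 1) then c ⟨i, h⟩ else 0, ?_⟩
    rw [← hc, ← Finset.sum_coe_sort]
    refine Finset.sum_congr rfl fun i _ => ?_
    simp only [i.2, dif_pos]
  refine ⟨c 0, fun k => c (k + 1), fun θ => ?_⟩
  have hT : ∀ k : ℕ, (Chebyshev.chebyshevTsequence ℝ k).eval (Real.cos θ)
      = Real.cos (k * θ) := by
    intro k
    have := Chebyshev.T_real_cos θ (k : ℤ)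
    rw [Int.cast_natCast] at this
    exact this
  rw [← hc, eval_finsetSum, Finset.sum_range_succ']
  simp only [eval_smul, hT, smul_eq_mul]
  push_cast
  simp [add_comm]

theorem cheb_aux_cos_sum (n m : ℕ) (hm : 0 < m) (hmn : m < 2 * n) :
    ∑ j ∈ Finset.range n, Real.cos (m * ((j + 1 / 2 : ℝ) * (Real.pi / n))) = 0 := by
  have hn : (0 : ℝ) < n := by
    have : 0 < n := by omega
    exact_mod_cast this
  have hs : 0 < Real.sin (m * Real.pi / (2 * n)) := by
    apply Real.sin_pos_of_pos_of_lt_pi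
    · have : (0 : ℝ) < m := by exact_mod_cast hm
      positivity
    · rw [div_lt_iff₀ (by positivity)]
      have : (m : ℝ) < 2 * n := by exact_mod_cast hmn
      nlinarith [Real.pi_pos]
  have key : 2 * Real.sin (m * Real.pi / (2 * n)) *
      ∑ j ∈ Finset.range n, Real.cos (m * ((j + 1 / 2 : ℝ) * (Real.pi / n))) = 0 := by
    rw [Finset.mul_sum]
    have : ∀ j ∈ Finset.range n, 2 * Real.sin (m * Real.pi / (2 * n)) *
        Real.cos (m * ((j + 1 / 2 : ℝ) * (Real.pi / n))) =
        Real.sin (m * ((j + 1 : ℕ) : ℝ) * Real.pi / n) - Real.sin (m * (j : ℝ) * Real.pi / n) := by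
      intro j _
      rw [Real.sin_sub_sin]
      congr 2
      · congr 1; push_cast; field_simp; ring
      · push_cast; field_simp; ring
    rw [Finset.sum_congr rfl this, Finset.sum_range_sub (fun j : ℕ => Real.sin (m * (j : ℝ) * Real.pi / n))]
    have h1 : (m : ℝ) * n * Real.pi / n = m * Real.pi := by field_simp
    simp [h1, Real.sin_nat_mul_pi]
  rcases mul_eq_zero.mp key with h | h
  · linarith
  · exact h

theorem cheb_aux_gram (n : ℕ) (k l : ℕ) (hk : k < n) (hl : l < n) (hkl : k ≠ l) :
    ∑ j ∈ Finset.range n, Real.sin ((k + 1 : ℝ) * ((j + 1 / 2 : ℝ) * (Real.pi / n))) *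
      Real.sin ((l + 1 : ℝ) * ((j + 1 / 2 : ℝ) * (Real.pi / n))) = 0 := by
  wlog h : l < k generalizing k l
  · have := this l k hl hk hkl.symm (by omega)
    rw [← this]
    exact Finset.sum_congr rfl fun j _ => mul_comm _ _
  have h1 := cheb_aux_cos_sum n (k - l) (by omega) (by omega)
  have h2 := cheb_aux_cos_sum n (k + l + 2) (by omega) (by omega)
  have h3 : ∀ j ∈ Finset.range n, Real.sin ((k + 1 : ℝ) * ((j + 1 / 2 : ℝ) * (Real.pi / n))) *
      Real.sin ((l + 1 : ℝ) * ((j + 1 / 2 : ℝ) * (Real.pi / n))) =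
      (1 / 2) * Real.cos ((k - l : ℕ) * ((j + 1 / 2 : ℝ) * (Real.pi / n))) -
      (1 / 2) * Real.cos ((k + l + 2 : ℕ) * ((j + 1 / 2 : ℝ) * (Real.pi / n))) := by
    intro j _
    generalize ((j + 1 / 2 : ℝ) * (Real.pi / n)) = t
    rw [Nat.cast_sub h.le]
    push_cast
    rw [show ((k : ℝ) - l) * t = (k + 1) * t - (l + 1) * t by ring,
      show ((k : ℝ) + l + 2) * t = (k + 1) * t + (l + 1) * t by ring, Real.cos_sub, Real.cos_add]
    ring
  rw [Finset.sum_congr rfl h3, Finset.sum_sub_distrib, ← Finset.mul_sum, ← Finset.mul_sum, h1, h2]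
  simp

theorem cheb_aux_gram_diag (n : ℕ) (k : ℕ) (hk : k < n) :
    (n : ℝ) / 2 ≤ ∑ j ∈ Finset.range n,
      Real.sin ((k + 1 : ℝ) * ((j + 1 / 2 : ℝ) * (Real.pi / n))) *
      Real.sin ((k + 1 : ℝ) * ((j + 1 / 2 : ℝ) * (Real.pi / n))) := by
  have h3 : ∀ j ∈ Finset.range n, Real.sin ((k + 1 : ℝ) * ((j + 1 / 2 : ℝ) * (Real.pi / n))) *
      Real.sin ((k + 1 : ℝ) * ((j + 1 / 2 : ℝ) * (Real.pi / n))) =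
      (1 / 2) - (1 / 2) * Real.cos ((2 * k + 2 : ℕ) * ((j + 1 / 2 : ℝ) * (Real.pi / n))) := by
    intro j _
    generalize ((j + 1 / 2 : ℝ) * (Real.pi / n)) = t
    push_cast
    rw [show (2 * (k : ℝ) + 2) * t = 2 * ((k + 1) * t) by ring, Real.cos_two_mul']
    nlinarith [Real.sin_sq_add_cos_sq ((k + 1) * t)]
  rw [Finset.sum_congr rfl h3, Finset.sum_sub_distrib, ← Finset.mul_sum]
  have h0 : ∑ j ∈ Finset.range n,
      Real.cos ((2 * k + 2 : ℕ) * ((j + 1 / 2 : ℝ) * (Real.pi / n))) ≤ 0 := by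
    by_cases hkn : k + 1 < n
    · exact (cheb_aux_cos_sum n (2 * k + 2) (by omega) (by omega)).le
    · have hkn' : n = k + 1 := by omega
      apply Finset.sum_nonpos
      intro j _
      have hn : (0 : ℝ) < n := by
        have : 0 < n := by omega
        exact_mod_cast this
      have : ((2 * k + 2 : ℕ) : ℝ) * ((j + 1 / 2 : ℝ) * (Real.pi / n))
          = j * (2 * Real.pi) + Real.pi := by
        have : ((2 * k + 2 : ℕ) : ℝ) = 2 * n := by rw [hkn']; push_cast; ring
        rw [this]; field_simp
      rw [this, Real.cos_nat_mul_two_pi_add_pi]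
      norm_num
  simp only [Finset.sum_const, Finset.card_range, nsmul_eq_mul]
  linarith

theorem cheb_aux_parseval (n : ℕ) (b : ℕ → ℝ) :
    (n : ℝ) / 2 * ∑ k ∈ Finset.range n, b k ^ 2 ≤ ∑ j ∈ Finset.range n,
      (∑ k ∈ Finset.range n,
        b k * Real.sin ((k + 1 : ℝ) * ((j + 1 / 2 : ℝ) * (Real.pi / n)))) ^ 2 := by
  have h : ∑ j ∈ Finset.range n, (∑ k ∈ Finset.range n,
        b k * Real.sin ((k + 1 : ℝ) * ((j + 1 / 2 : ℝ) * (Real.pi / n)))) ^ 2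
      = ∑ k ∈ Finset.range n, ∑ l ∈ Finset.range n, b k * b l * ∑ j ∈ Finset.range n,
      Real.sin ((k + 1 : ℝ) * ((j + 1 / 2 : ℝ) * (Real.pi / n))) *
      Real.sin ((l + 1 : ℝ) * ((j + 1 / 2 : ℝ) * (Real.pi / n))) := by
    simp only [sq, Finset.sum_mul_sum]
    simp only [Finset.mul_sum]
    rw [Finset.sum_comm]
    refine Finset.sum_congr rfl fun k _ => ?_
    rw [Finset.sum_comm]
    refine Finset.sum_congr rfl fun l _ => Finset.sum_congr rfl fun j _ => ?_
    ring
  rw [h, Finset.mul_sum]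
  refine Finset.sum_le_sum fun k hk => ?_
  rw [Finset.sum_eq_single k]
  · have := cheb_aux_gram_diag n k (Finset.mem_range.mp hk)
    nlinarith [sq_nonneg (b k)]
  · intro l hl hlk
    rw [cheb_aux_gram n k l (Finset.mem_range.mp hk) (Finset.mem_range.mp hl) hlk.symm, mul_zero]
  · intro h; exact absurd hk h

theorem cheb_aux_coeff (n : ℕ) (hn : 1 ≤ n) (c L : ℝ) (a : ℕ → ℝ) (q : ℝ → ℝ)
    (hq : ∀ θ, q θ = c + ∑ k ∈ Finset.range n, a k * Real.cos ((k + 1 : ℝ) * θ))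
    (hL : ∀ j < n, |q ((j + 1 : ℕ) * Real.pi / n) - q ((j : ℕ) * Real.pi / n)|
      ≤ L * (Real.pi / n)) :
    ∑ k ∈ Finset.range n, ((k + 1 : ℝ) * a k) ^ 2 ≤ (L * Real.pi) ^ 2 / 2 := by
  have hn0 : (0 : ℝ) < n := by exact_mod_cast hn
  have hdiff : ∀ j : ℕ, q ((j + 1 : ℕ) * Real.pi / n) - q ((j : ℕ) * Real.pi / n) =
      ∑ k ∈ Finset.range n, (-2 * a k * Real.sin ((k + 1 : ℝ) * Real.pi / (2 * n))) *
        Real.sin ((k + 1 : ℝ) * ((j + 1 / 2 : ℝ) * (Real.pi / n))) := by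
    intro j
    rw [hq, hq, add_sub_add_left_eq_sub, ← Finset.sum_sub_distrib]
    refine Finset.sum_congr rfl fun k _ => ?_
    rw [← mul_sub, Real.cos_sub_cos]
    have e1 : ((k + 1 : ℝ) * (((j + 1 : ℕ) : ℝ) * Real.pi / n) + (k + 1) * (j * Real.pi / n)) / 2
        = (k + 1 : ℝ) * ((j + 1 / 2 : ℝ) * (Real.pi / n)) := by
      push_cast; field_simp; ring
    have e2 : ((k + 1 : ℝ) * (((j + 1 : ℕ) : ℝ) * Real.pi / n) - (k + 1) * (j * Real.pi / n)) / 2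
        = (k + 1 : ℝ) * Real.pi / (2 * n) := by
      push_cast; field_simp; ring
    rw [e1, e2]; ring
  have hP := cheb_aux_parseval n
    (fun k => -2 * a k * Real.sin ((k + 1 : ℝ) * Real.pi / (2 * n)))
  simp only [← hdiff] at hP
  have hR : ∑ j ∈ Finset.range n,
      (q ((j + 1 : ℕ) * Real.pi / n) - q ((j : ℕ) * Real.pi / n)) ^ 2
      ≤ n * (L * (Real.pi / n)) ^ 2 := by
    calc _ ≤ ∑ j ∈ Finset.range n, (L * (Real.pi / n)) ^ 2 := by
          refine Finset.sum_le_sum fun j hj => ?_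
          rw [← sq_abs]
          exact pow_le_pow_left₀ (abs_nonneg _) (hL j (Finset.mem_range.mp hj)) 2
      _ = _ := by simp
  have hS : 4 / (n : ℝ) ^ 2 * ∑ k ∈ Finset.range n, ((k + 1 : ℝ) * a k) ^ 2 ≤
      ∑ k ∈ Finset.range n, (-2 * a k * Real.sin ((k + 1 : ℝ) * Real.pi / (2 * n))) ^ 2 := by
    rw [Finset.mul_sum]
    refine Finset.sum_le_sum fun k hk => ?_
    have hk' : (k + 1 : ℝ) ≤ n := by exact_mod_cast Finset.mem_range.mp hk
    have hs := Real.mul_le_sin (x := (k + 1 : ℝ) * Real.pi / (2 * n)) (by positivity)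
      (by rw [div_le_div_iff₀ (by positivity) (by norm_num)]; nlinarith [Real.pi_pos])
    have e : 2 / Real.pi * ((k + 1 : ℝ) * Real.pi / (2 * n)) = (k + 1) / n := by
      field_simp
    rw [e] at hs
    have hs2 := pow_le_pow_left₀ (by positivity) hs 2
    have : 4 / (n : ℝ) ^ 2 * ((k + 1 : ℝ) * a k) ^ 2 = 4 * a k ^ 2 * ((k + 1) / n) ^ 2 := by
      field_simp
    rw [this]
    nlinarith [mul_le_mul_of_nonneg_left hs2 (by positivity : 0 ≤ 4 * a k ^ 2)]
  have h1 := (mul_le_mul_of_nonneg_left hS (by positivity : 0 ≤ (n : ℝ) / 2)).trans (hP.trans hR)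
  have e1 : (n : ℝ) / 2 * (4 / (n : ℝ) ^ 2 * ∑ k ∈ Finset.range n, ((k + 1 : ℝ) * a k) ^ 2)
      = (2 * ∑ k ∈ Finset.range n, ((k + 1 : ℝ) * a k) ^ 2) / n := by
    field_simp; norm_num
  have e2 : (n : ℝ) * (L * (Real.pi / n)) ^ 2 = (L * Real.pi) ^ 2 / n := by
    field_simp
  rw [e1, e2, div_le_div_iff_of_pos_right hn0] at h1
  linarith

theorem cheb_aux_osc (n : ℕ) (c L : ℝ) (hL : 0 ≤ L) (a : ℕ → ℝ) (q : ℝ → ℝ)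
    (hq : ∀ θ, q θ = c + ∑ k ∈ Finset.range n, a k * Real.cos ((k + 1 : ℝ) * θ))
    (ha : ∑ k ∈ Finset.range n, ((k + 1 : ℝ) * a k) ^ 2 ≤ (L * Real.pi) ^ 2 / 2)
    (θ φ : ℝ) : |q θ - q φ| ≤ Real.sqrt n * (L * Real.pi) * |θ - φ| := by
  have h1 : |q θ - q φ| ≤ (∑ k ∈ Finset.range n, |(k + 1 : ℝ) * a k|) * |θ - φ| := by
    rw [hq, hq, add_sub_add_left_eq_sub, ← Finset.sum_sub_distrib, Finset.sum_mul]
    refine (Finset.abs_sum_le_sum_abs _ _).trans (Finset.sum_le_sum fun k _ => ?_)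
    rw [← mul_sub, abs_mul, abs_mul, mul_comm |(k + 1 : ℝ)|, mul_assoc,
      ← abs_mul (k + 1 : ℝ), mul_sub (k + 1 : ℝ)]
    exact mul_le_mul_of_nonneg_left (Real.abs_cos_sub_cos_le _ _) (abs_nonneg _)
  refine h1.trans (mul_le_mul_of_nonneg_right ?_ (abs_nonneg _))
  have h2 := sq_sum_le_card_mul_sum_sq (s := Finset.range n) (f := fun k => |(k + 1 : ℝ) * a k|)
  simp only [sq_abs, Finset.card_range] at h2
  refine le_of_abs_le (abs_le_of_sq_le_sq ?_ (by positivity))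
  rw [mul_pow, Real.sq_sqrt (by positivity)]
  refine h2.trans (mul_le_mul_of_nonneg_left ?_ (by positivity))
  nlinarith [sq_nonneg (L * Real.pi)]

/-- If `f` is Lipschitz continuous on `[−1, 1]` and, for each `n ≥ 1`, `p_n` is the
polynomial of degree at most `n` interpolating `f` at the `n + 1` Chebyshev–Lobatto nodes
`cos(kπ/n)`, `k = 0, …, n`, then `p_n → f` uniformly on `[−1, 1]`. -/
theorem chebyshev_interpolation_uniform_convergence (f : ℝ → ℝ)
    (hf : ∃ L : ℝ, 0 ≤ L ∧ ∀ x ∈ Set.Icc (-1 : ℝ) 1, ∀ y ∈ Set.Icc (-1 : ℝ) 1,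
      |f x - f y| ≤ L * |x - y|)
    (p : ℕ → Polynomial ℝ)
    (hp : ∀ n : ℕ, 1 ≤ n → (p n).natDegree ≤ n ∧
      ∀ k : ℕ, k ≤ n →
        (p n).eval (Real.cos (k * Real.pi / n)) = f (Real.cos (k * Real.pi / n))) :
    ∀ ε > (0 : ℝ), ∃ N : ℕ, ∀ n ≥ N, ∀ x ∈ Set.Icc (-1 : ℝ) 1,
      |f x - (p n).eval x| ≤ ε := by
  obtain ⟨L, hL, hf⟩ := hf
  have hg : ∀ θ φ : ℝ, |f (Real.cos θ) - f (Real.cos φ)| ≤ L * |θ - φ| := fun θ φ =>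
    (hf _ ⟨Real.neg_one_le_cos _, Real.cos_le_one _⟩ _
      ⟨Real.neg_one_le_cos _, Real.cos_le_one _⟩).trans
      (mul_le_mul_of_nonneg_left (Real.abs_cos_sub_cos_le _ _) hL)
  have main : ∀ n : ℕ, 1 ≤ n → ∀ x ∈ Set.Icc (-1 : ℝ) 1,
      |f x - (p n).eval x| ≤ (L * Real.pi + L * Real.pi ^ 2) / Real.sqrt n := by
    intro n hn x hx
    have hn1 : (1 : ℝ) ≤ n := by exact_mod_cast hn
    have hn0 : (0 : ℝ) < n := by linarith
    obtain ⟨hdeg, hint⟩ := hp n hn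
    obtain ⟨c, a, hq⟩ := cheb_aux_expand n (p n) hdeg
    have ha := cheb_aux_coeff n hn c L a (fun θ => (p n).eval (Real.cos θ)) hq (by
      intro j hj
      rw [hint (j + 1) (by omega), hint j (by omega)]
      refine (hg _ _).trans (le_of_eq ?_)
      congr 1
      rw [show ((j + 1 : ℕ) : ℝ) * Real.pi / n - j * Real.pi / n = Real.pi / n by
        push_cast; field_simp; ring]
      exact abs_of_nonneg (by positivity))
    have hosc := cheb_aux_osc n c L hL a (fun θ => (p n).eval (Real.cos θ)) hq ha
    set θ := Real.arccos x with hθ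
    have hcos : Real.cos θ = x := Real.cos_arccos hx.1 hx.2
    have hθ0 : 0 ≤ θ := Real.arccos_nonneg x
    have hθπ : θ ≤ Real.pi := Real.arccos_le_pi x
    obtain ⟨j, hj, hjd⟩ : ∃ j : ℕ, j ≤ n ∧ |θ - j * Real.pi / n| ≤ Real.pi / n := by
      refine ⟨⌊θ * n / Real.pi⌋₊, ?_, ?_⟩
      · apply Nat.floor_le_of_le
        rw [div_le_iff₀ Real.pi_pos]
        nlinarith
      · have h1 := Nat.floor_le (show 0 ≤ θ * n / Real.pi by positivity)
        have h2 := Nat.lt_floor_add_one (θ * n / Real.pi)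
        rw [le_div_iff₀ Real.pi_pos] at h1
        rw [div_lt_iff₀ Real.pi_pos] at h2
        have e : θ - ⌊θ * n / Real.pi⌋₊ * Real.pi / n
          = (θ * n - ⌊θ * n / Real.pi⌋₊ * Real.pi) / n := by field_simp
        rw [e, abs_of_nonneg (div_nonneg (by linarith) hn0.le), div_le_div_iff_of_pos_right hn0]
        linarith
    have b1 := hg θ (j * Real.pi / n)
    have b2 := hosc (j * Real.pi / n) θ
    rw [hint j hj, abs_sub_comm _ θ] at b2
    rw [hcos] at b1 b2
    have hs0 : 0 < Real.sqrt n := Real.sqrt_pos.mpr hn0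
    have hs1 : 1 ≤ Real.sqrt n := Real.one_le_sqrt.mpr hn1
    have hss : Real.sqrt n * Real.sqrt n = n := Real.mul_self_sqrt hn0.le
    have b1' : L * |θ - j * Real.pi / n| ≤ L * Real.pi / Real.sqrt n := by
      rw [mul_div_assoc L]
      refine mul_le_mul_of_nonneg_left (hjd.trans ?_) hL
      exact div_le_div_of_nonneg_left Real.pi_pos.le hs0 (by nlinarith)
    have b2' : Real.sqrt n * (L * Real.pi) * |θ - j * Real.pi / n|
        ≤ L * Real.pi ^ 2 / Real.sqrt n := by
      refine (mul_le_mul_of_nonneg_left hjd (by positivity)).trans (le_of_eq ?_)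
      rw [← mul_div_assoc, div_eq_div_iff hn0.ne' hs0.ne']
      linear_combination (L * Real.pi ^ 2) * hss
    calc |f x - (p n).eval x| ≤ |f x - f (Real.cos (j * Real.pi / n))|
          + |f (Real.cos (j * Real.pi / n)) - (p n).eval x| := abs_sub_le _ _ _
      _ ≤ _ := by rw [add_div]; linarith
  intro ε hε
  obtain ⟨M, hM⟩ := exists_nat_ge (((L * Real.pi + L * Real.pi ^ 2) / ε) ^ 2)
  refine ⟨M + 1, fun n hn x hx => (main n (by omega) x hx).trans ?_⟩
  have hn1 : (0 : ℝ) < n := by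
    have : 0 < n := by omega
    exact_mod_cast this
  rw [div_le_iff₀ (Real.sqrt_pos.mpr hn1), ← div_le_iff₀' hε]
  apply Real.le_sqrt_of_sq_le
  have : (M : ℝ) ≤ n := by exact_mod_cast (by omega : M ≤ n)
  linarith
end

section
/- (Faber's theorem / non-universality of polynomial interpolation) For every triangular array of nodes (x_{n,k})_{0 ≤ k ≤ n, n ∈ ℕ} with x_{n,0}, …, x_{n,n} ∈ [−1, 1] pairwise distinct for each n, there exists a continuous function f : [−1, 1] → ℝ such that the interpolating polynomials p_n (the unique polynomial of degree at most n with p_n(x_{n,k}) = f(x_{n,k}) for k = 0, …, n) do not converge uniformly to f on [−1, 1]. -/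
open Filter
namespace FaberAux
open Polynomial Real

lemma abs_sin_le (k : ℕ) (u : ℝ) : |sin (k * u)| ≤ k * |sin u| := by
  induction k with
  | zero => simp
  | succ k ih =>
    push_cast
    rw [add_mul, one_mul, sin_add]
    calc _ ≤ |sin (k*u) * cos u| + |cos (k*u) * sin u| := abs_add_le _ _
      _ ≤ |sin (k*u)| * 1 + 1 * |sin u| := by
        rw [abs_mul, abs_mul]
        gcongr <;> exact abs_cos_le_one _
      _ ≤ _ := by linarith

lemma abel (a c : ℕ → ℝ) (ha : Antitone a) (h0 : ∀ n, 0 ≤ a n) (hc : ∀ n, |c n| ≤ 1) (m n : ℕ)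
    (h : m ≤ n) : |∑ k ∈ Finset.Ico m n, a k * (c k - c (k+1))| ≤ 2 * a m := by
  have key : |∑ k ∈ Finset.Ico m n, a k * (c k - c (k+1)) + a n * c n| ≤ 2 * a m - a n := by
    induction n, h using Nat.le_induction with
    | base => 
      have := hc m
      simp only [Finset.Ico_self, Finset.sum_empty, zero_add, abs_mul, abs_of_nonneg (h0 m)]
      nlinarith [h0 m]
    | succ n hmn ih =>
      rw [Finset.sum_Ico_succ_top hmn]
      have h1 : |(a n - a (n+1)) * c (n+1)| ≤ a n - a (n+1) := by
        have := ha (Nat.le_succ n)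
        rw [abs_mul, abs_of_nonneg (by simpa using this)]
        have := hc (n+1)
        have : 0 ≤ a n - a (n+1) := by simpa using ha (Nat.le_succ n)
        nlinarith
      rw [abs_le] at *
      constructor <;> linarith
  have h2 : |a n * c n| ≤ a n := by
    rw [abs_mul, abs_of_nonneg (h0 n)]; nlinarith [h0 n, hc n]
  rw [abs_le] at *
  constructor <;> linarith

lemma sinsum (n : ℕ) (θ : ℝ) : |∑ k ∈ Finset.range n, sin ((k+1) * θ) / (k+1)| ≤ 3 := by
  set s := |sin (θ/2)| with hs
  have hk : ∀ k : ℕ, |sin ((k+1) * θ) / (k+1)| ≤ 2 * s := by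
    intro k
    have h1 := abs_sin_le (2*(k+1)) (θ/2)
    push_cast at h1
    rw [show 2 * ((k:ℝ)+1) * (θ/2) = (k+1)*θ by ring] at h1
    have : (0:ℝ) < k+1 := by positivity
    rw [abs_div, abs_of_pos this, div_le_iff₀ this]
    linarith
  have hs0 : 0 ≤ s := abs_nonneg _
  have hpre : ∀ m : ℕ, |∑ k ∈ Finset.range m, sin ((k+1) * θ) / (k+1)| ≤ m * (2 * s) := by
    intro m
    refine (Finset.abs_sum_le_sum_abs _ _).trans ?_
    refine (Finset.sum_le_card_nsmul _ _ _ (fun k _ => hk k)).trans ?_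
    simp
  rcases hs0.eq_or_lt with h0 | hpos
  · have := hpre n
    rw [← h0] at this
    simp at this
    rw [this]; norm_num
  have htail : ∀ m : ℕ, m ≤ n → |∑ k ∈ Finset.Ico m n, sin ((k+1) * θ) / (k+1)| ≤ 1 / (s * (m+1)) := by
    intro m hm
    have h1 := abel (fun k => 1 / ((k:ℝ)+1)) (fun k => cos ((k+1/2)*θ)) 
      (fun i j hij => by
        have : (i:ℝ) ≤ j := by exact_mod_cast hij
        dsimp only
        gcongr) (fun _ => by positivity) (fun _ => abs_cos_le_one _) m n hm
    have h2 : ∑ k ∈ Finset.Ico m n, 1 / ((k:ℝ)+1) * (cos ((k+1/2)*θ) - cos (((k+1:ℕ)+1/2)*θ))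
        = (2 * sin (θ/2)) * ∑ k ∈ Finset.Ico m n, sin ((k+1) * θ) / (k+1) := by
      rw [Finset.mul_sum]
      refine Finset.sum_congr rfl fun k _ => ?_
      rw [cos_sub_cos]
      push_cast
      rw [show (((k:ℝ)+1/2)*θ + (k+1+1/2)*θ)/2 = (k+1)*θ by ring,
        show (((k:ℝ)+1/2)*θ - (k+1+1/2)*θ)/2 = -(θ/2) by ring, sin_neg]
      ring
    rw [h2, abs_mul, abs_mul, ← hs, abs_two] at h1
    rw [le_div_iff₀ (by positivity)]
    have hm0 : (0:ℝ) < m + 1 := by positivity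
    have h3 := mul_le_mul_of_nonneg_right h1 hm0.le
    rw [show 2 * (1 / ((m:ℝ)+1)) * (m+1) = 2 by field_simp] at h3
    nlinarith
  set m := ⌊1/s⌋₊ with hm
  have hm1 : (m:ℝ) * s ≤ 1 := by
    have := Nat.floor_le (show 0 ≤ 1/s by positivity)
    rwa [← hm, le_div_iff₀ hpos] at this
  have hm2 : 1 ≤ s * (m+1) := by
    have := (Nat.lt_floor_add_one (1/s)).le
    rw [← hm, div_le_iff₀ hpos] at this
    linarith
  rcases le_total n m with h | h
  · have := hpre n
    have h' : (n:ℝ) ≤ m := by exact_mod_cast h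
    nlinarith
  · rw [← Finset.sum_range_add_sum_Ico _ h]
    refine (abs_add_le _ _).trans ?_
    have h1 := hpre m
    have h2 := htail m h
    have h3 : 1 / (s * ((m:ℝ)+1)) ≤ 1 := by rw [div_le_one (by positivity)]; exact hm2
    linarith

lemma ortho (m : ℕ) (q : ℝ[X]) (hq : q.degree < m) :
    ∫ t in (0:ℝ)..π, cos (m * t) * q.eval (cos t) = 0 := by
  have hmem := mem_degreeLT.mpr hq
  clear hq
  rw [← Sequence.span_degreeLT (Chebyshev.chebyshevTsequence ℝ) (by simp)] at hmem
  induction hmem using Submodule.span_induction with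
  | mem p hp =>
    obtain ⟨j, hj, rfl⟩ := hp
    have := Chebyshev.integral_eval_T_real_mul_eval_T_real_measureT_of_ne (n := m) (m := j)
      (by simp at hj; omega)
    rw [Chebyshev.integral_measureT_eq_integral_cos] at this
    simpa [Chebyshev.chebyshevTsequence] using this
  | zero => simp
  | add p q _ _ hp hq => 
    simp only [eval_add, mul_add]
    rw [intervalIntegral.integral_add, hp, hq, add_zero] <;>
    exact Continuous.intervalIntegrable (by fun_prop) _ _
  | smul a p _ hp =>
    simp only [eval_smul, smul_eq_mul]
    simp_rw [mul_left_comm _ a]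
    rw [intervalIntegral.integral_const_mul, hp, mul_zero]

lemma selfint (m : ℕ) : π / 2 ≤ ∫ t in (0:ℝ)..π, cos (m * t) * cos (m * t) := by
  rcases eq_or_ne m 0 with rfl | h
  · simp; linarith [pi_pos]
  · have := Chebyshev.integral_T_real_mul_self_measureT_of_ne_zero h
    rw [Chebyshev.integral_measureT_eq_integral_cos] at this
    simp at this
    exact this.ge

lemma fejer_bound (n : ℕ) (θ : ℝ) :
    |∑ k ∈ Finset.range n, (cos ((n - (k+1)) * θ) - cos ((n+(k+1)) * θ)) / (k+1)| ≤ 6 := by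
  have : ∑ k ∈ Finset.range n, (cos ((n - (k+1)) * θ) - cos ((n+(k+1)) * θ)) / (k+1)
      = (2 * sin (n * θ)) * ∑ k ∈ Finset.range n, sin ((k+1) * θ) / (k+1) := by
    rw [Finset.mul_sum]
    refine Finset.sum_congr rfl fun k _ => ?_
    rw [sub_mul (n:ℝ), add_mul (n:ℝ), cos_sub, cos_add]; ring
  rw [this, abs_mul, abs_mul, abs_two]
  have h1 := sinsum n θ
  have h2 := abs_sin_le_one (n * θ)
  have := mul_le_mul h2 h1 (abs_nonneg _) zero_le_one
  linarith

noncomputable def F (n : ℕ) (t : ℝ) : ℝ[X] :=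
  ∑ k ∈ Finset.range n, ((2 / ((k:ℝ)+1) * cos ((n-(k+1) : ℕ) * t)) • Chebyshev.T ℝ (n-(k+1) : ℕ)
    - (2 / ((k:ℝ)+1) * cos ((n+(k+1) : ℕ) * t)) • Chebyshev.T ℝ (n+(k+1) : ℕ))

lemma F_bound (n : ℕ) (t : ℝ) (y : ℝ) (hy : y ∈ Set.Icc (-1:ℝ) 1) : |(F n t).eval y| ≤ 12 := by
  obtain ⟨θ, rfl⟩ : ∃ θ, y = cos θ := ⟨arccos y, (cos_arccos hy.1 hy.2).symm⟩
  have : (F n t).eval (cos θ) = 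
     (∑ k ∈ Finset.range n, (cos ((n - (k+1)) * (θ+t)) - cos ((n+(k+1)) * (θ+t))) / (k+1)) +
     ∑ k ∈ Finset.range n, (cos ((n - (k+1)) * (θ-t)) - cos ((n+(k+1)) * (θ-t))) / (k+1) := by
    rw [F, eval_finsetSum, ← Finset.sum_add_distrib]
    refine Finset.sum_congr rfl fun k hk => ?_
    have hk' : k + 1 ≤ n := by simp at hk; omega
    simp only [eval_sub, eval_smul, Chebyshev.T_real_cos, smul_eq_mul, Int.cast_natCast,
      Nat.cast_sub hk']
    push_cast
    simp only [mul_add ((n:ℝ) - (k+1)), mul_sub ((n:ℝ) - (k+1)), mul_add ((n:ℝ) + (k+1)),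
      mul_sub ((n:ℝ) + (k+1)), cos_add (((n:ℝ) - (k+1)) * θ), cos_sub (((n:ℝ) - (k+1)) * θ),
      cos_add (((n:ℝ) + (k+1)) * θ), cos_sub (((n:ℝ) + (k+1)) * θ)]
    ring
  rw [this]
  have h1 := fejer_bound n (θ+t)
  have h2 := fejer_bound n (θ-t)
  exact (abs_add_le _ _).trans (by linarith)

lemma key (Λ : ℝ[X] →ₗ[ℝ] ℝ[X]) (n : ℕ) (hdeg : ∀ P, (Λ P).natDegree ≤ n)
    (hproj : ∀ P : ℝ[X], P.natDegree ≤ n → Λ P = P) (C : ℝ)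
    (hC : ∀ (P : ℝ[X]) (M : ℝ), (∀ y ∈ Set.Icc (-1:ℝ) 1, |P.eval y| ≤ M) →
      ∀ y ∈ Set.Icc (-1:ℝ) 1, |(Λ P).eval y| ≤ C * M) :
    ∑ k ∈ Finset.range n, (1 / (k+1) : ℝ) ≤ 12 * C := by
  have e : ∀ t, (Λ (F n t)).eval (cos t) = ∑ k ∈ Finset.range n, (2 / ((k:ℝ)+1)) *
      ((cos ((n-(k+1) : ℕ) * t) * cos ((n-(k+1) : ℕ) * t))
        - cos ((n+(k+1) : ℕ) * t) * (Λ (Chebyshev.T ℝ (n+(k+1) : ℕ))).eval (cos t)) := by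
    intro t
    rw [F, map_sum, eval_finsetSum]
    refine Finset.sum_congr rfl fun k hk => ?_
    rw [map_sub, map_smul, map_smul, hproj (Chebyshev.T ℝ (n-(k+1) : ℕ))
      (by rw [Chebyshev.natDegree_T]; simp)]
    simp only [eval_sub, eval_smul, Chebyshev.T_real_cos, smul_eq_mul, Int.cast_natCast]
    ring
  have b : ∀ t, |(Λ (F n t)).eval (cos t)| ≤ C * 12 := fun t =>
    hC _ _ (F_bound n t) _ (cos_mem_Icc t)
  have u := intervalIntegral.norm_integral_le_of_norm_le_const (a := 0) (b := π)
    (f := fun t => (Λ (F n t)).eval (cos t)) (C := C*12) (fun t _ => b t)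
  have l : π * ∑ k ∈ Finset.range n, (1 / (k+1) : ℝ) ≤
      ∫ t in (0:ℝ)..π, (Λ (F n t)).eval (cos t) := by
    simp_rw [e]
    rw [intervalIntegral.integral_finsetSum
      (fun _ _ => Continuous.intervalIntegrable (by fun_prop) _ _), Finset.mul_sum]
    refine Finset.sum_le_sum fun k hk => ?_
    rw [intervalIntegral.integral_const_mul, intervalIntegral.integral_sub
      (Continuous.intervalIntegrable (by fun_prop) _ _)
      (Continuous.intervalIntegrable (by fun_prop) _ _), ortho, sub_zero]
    · have := selfint (n-(k+1))
      have h2 : (0:ℝ) ≤ 2/((k:ℝ)+1) := by positivity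
      have := mul_le_mul_of_nonneg_left this h2
      refine le_trans (le_of_eq ?_) this
      ring
    · refine lt_of_le_of_lt (degree_le_of_natDegree_le (hdeg _)) ?_
      exact_mod_cast (by omega : n < n + (k+1))
  rw [sub_zero, abs_of_pos pi_pos, Real.norm_eq_abs] at u
  have := l.trans ((le_abs_self _).trans u)
  nlinarith [pi_pos]

end FaberAux

theorem faber_nonuniversality (x : ℕ → ℕ → ℝ)
    (hmem : ∀ n : ℕ, ∀ k ≤ n, x n k ∈ Set.Icc (-1 : ℝ) 1)
    (hdist : ∀ n : ℕ, ∀ k ≤ n, ∀ l ≤ n, k ≠ l → x n k ≠ x n l) :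
    ∃ f : ℝ → ℝ, ContinuousOn f (Set.Icc (-1 : ℝ) 1) ∧
      ∀ p : ℕ → Polynomial ℝ,
        (∀ n : ℕ, (p n).natDegree ≤ n ∧ ∀ k ≤ n, (p n).eval (x n k) = f (x n k)) →
        ¬ TendstoUniformlyOn (fun n t => (p n).eval t) f atTop (Set.Icc (-1 : ℝ) 1) := by
  classical
  by_contra! H
  let I := Set.Icc (-1:ℝ) 1
  have hinj : ∀ n, Set.InjOn (x n) (Finset.range (n+1) : Set ℕ) := by
    intro n k hk l hl h
    simp at hk hl
    by_contra hne
    exact hdist n k (by omega) l (by omega) hne h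
  -- clamped nodes
  let z : ℕ → ℕ → I := fun n k => Set.projIcc (-1:ℝ) 1 (by norm_num) (x n k)
  have hz : ∀ n k, k ≤ n → (z n k : ℝ) = x n k := fun n k hk => by
    simp only [z]; rw [Set.projIcc_of_mem _ (hmem n k hk)]
  let B : ℕ → ℕ → C(I, ℝ) := fun n k =>
    (Lagrange.basis (Finset.range (n+1)) (x n) k).toContinuousMapOn I
  let L : ℕ → C(I, ℝ) →L[ℝ] C(I, ℝ) := fun n =>
    ∑ k ∈ Finset.range (n+1), (ContinuousMap.evalCLM ℝ (z n k)).smulRight (B n k)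
  have hL : ∀ n (f : ℝ → ℝ) (g : C(I, ℝ)), (∀ y : I, g y = f y) → ∀ y : I,
      L n g y = (Lagrange.interpolate (Finset.range (n+1)) (x n) (fun k => f (x n k))).eval
        (y:ℝ) := by
    intro n f g hfg y
    simp only [L, B, ContinuousLinearMap.sum_apply, ContinuousMap.sum_apply,
      Lagrange.interpolate_apply, Polynomial.eval_finsetSum]
    refine Finset.sum_congr rfl fun k hk => ?_
    have hk' : k ≤ n := by simp at hk; omega
    simp [hfg, hz n k hk']
  have hbd : ∀ g : C(I, ℝ), ∃ C, ∀ n, ‖L n g‖ ≤ C := by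
    intro g
    let f := Set.IccExtend (by norm_num : (-1:ℝ) ≤ 1) g
    have hf : Continuous f := g.continuous.Icc_extend'
    have hfg : ∀ y : I, g y = f y := fun y => by simp [f]
    obtain ⟨p, hp, hpu⟩ := H f hf.continuousOn
    have hpe : ∀ n, p n = Lagrange.interpolate (Finset.range (n+1)) (x n)
        (fun k => f (x n k)) := by
      intro n
      refine Lagrange.eq_interpolate_of_eval_eq _ (hinj n) ?_ ?_
      · refine lt_of_le_of_lt (Polynomial.degree_le_of_natDegree_le (hp n).1) ?_
        simp only [Finset.card_range]
        exact_mod_cast Nat.lt_succ_self n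
      · intro k hk
        exact (hp n).2 k (by simp at hk; omega)
    have ht : Tendsto (fun n => L n g) atTop (nhds g) := by
      rw [ContinuousMap.tendsto_iff_tendstoUniformly]
      rw [tendstoUniformlyOn_iff_tendstoUniformly_comp_coe] at hpu
      convert hpu using 1
      · funext n y
        rw [hL n f g hfg y, ← hpe n]
      · funext y
        exact hfg y
    obtain ⟨C, hC⟩ := (Metric.isBounded_range_of_tendsto _ ht).exists_norm_le
    exact ⟨C, fun n => hC _ ⟨n, rfl⟩⟩
  obtain ⟨C, hC⟩ := banach_steinhaus hbd
  have hfin : ∀ n, ∑ k ∈ Finset.range n, (1 / (k+1) : ℝ) ≤ 12 * C := by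
    intro n
    let E : Polynomial ℝ →ₗ[ℝ] (ℕ → ℝ) := LinearMap.pi fun k => Polynomial.leval (x n k)
    refine FaberAux.key
      ((Lagrange.interpolate (Finset.range (n+1)) (x n)).comp E) n ?_ ?_ C ?_
    · intro P
      refine Polynomial.natDegree_le_of_degree_le ?_
      simpa using Lagrange.degree_interpolate_le (E P) (hinj n)
    · intro P hP
      refine (Lagrange.eq_interpolate_of_eval_eq _ (hinj n) ?_ ?_).symm
      · refine lt_of_le_of_lt (Polynomial.degree_le_of_natDegree_le hP) ?_
        simp only [Finset.card_range]
        exact_mod_cast Nat.lt_succ_self n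
      · intro k _
        simp [E]
    · intro P M hM y hy
      have h1 := hL n (fun t => P.eval t) (P.toContinuousMapOn I) (fun _ => rfl) ⟨y, hy⟩
      have h2 : ((Lagrange.interpolate (Finset.range (n+1)) (x n)).comp E) P =
        Lagrange.interpolate (Finset.range (n+1)) (x n) (fun k => P.eval (x n k)) := rfl
      rw [h2, ← h1]
      have hM0 : 0 ≤ M := (abs_nonneg _).trans (hM y hy)
      have h3 : ‖P.toContinuousMapOn I‖ ≤ M :=
        (ContinuousMap.norm_le _ hM0).2 fun w => hM w w.2
      calc |L n (P.toContinuousMapOn I) ⟨y, hy⟩| ≤ ‖L n (P.toContinuousMapOn I)‖ :=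
            (L n (P.toContinuousMapOn I)).norm_coe_le_norm ⟨y, hy⟩
        _ ≤ ‖L n‖ * ‖P.toContinuousMapOn I‖ := (L n).le_opNorm _
        _ ≤ C * M := mul_le_mul (hC n) h3 (norm_nonneg _) ((norm_nonneg _).trans (hC n))
  obtain ⟨n, hn⟩ := (Real.tendsto_sum_range_one_div_nat_succ_atTop.eventually_gt_atTop
    (12 * C)).exists
  exact absurd (hfin n) (not_le.2 hn)
end
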